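/- For k ≥ 4, define C_k := min{ (2d)^s / μ_k(B(x,d)) : x ∈ A_k ∩ S₀₁, d = |y − x| for some y ∈ A_k, √3/16 ≤ d ≤ √3/8 + 2^{1−k} }, let B(x_k, d_k) be any ball attaining this minimum, and set C_k^inf := (1 + 2^{5−k}/√3)^{−s} · C_k and C_k^sup := (2d_k)^s / μ_k(B(x_k, d_k − 2^{−k})). Then C_k^inf ≤ C₀^s(S) ≤ C_k^sup. -/

import Mathlib

open MeasureTheory Metric Set
open scoped ENNReal

noncomputable section

/-- The point `(a, b)` of the Euclidean plane. -/
def pt (a b : ℝ) : EuclideanSpace ℝ (Fin 2) := (WithLp.equiv 2 (Fin 2 → ℝ)).symm ![a, b]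

/-- The translation vectors of the three similitudes. -/
def v : Fin 3 → EuclideanSpace ℝ (Fin 2)
  | 0 => pt 0 0
  | 1 => pt (1/2) 0
  | 2 => pt (1/4) (Real.sqrt 3 / 4)

/-- The three similitudes generating the Sierpinski gasket. -/
def f (i : Fin 3) (x : EuclideanSpace ℝ (Fin 2)) : EuclideanSpace ℝ (Fin 2) :=
  (1/2 : ℝ) • x + v i

/-- `fword [i₁, …, i_k] = f_{i₁} ∘ ⋯ ∘ f_{i_k}`. -/
def fword : List (Fin 3) → EuclideanSpace ℝ (Fin 2) → EuclideanSpace ℝ (Fin 2)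
  | [] => id
  | i :: l => f i ∘ fword l

/-- The similarity dimension `s = log 3 / log 2`. -/
def sDim : ℝ := Real.log 3 / Real.log 2

/-- The normalised Hausdorff measure `μ = H^s(S)⁻¹ • H^s⌊S`. -/
def muS (S : Set (EuclideanSpace ℝ (Fin 2))) : Measure (EuclideanSpace ℝ (Fin 2)) :=
  (μH[sDim] S)⁻¹ • (μH[sDim]).restrict S

/-- Fixed points `z_i = 2 v_i`. -/
def z (i : Fin 3) : EuclideanSpace ℝ (Fin 2) := (2 : ℝ) • v i

/-- The Hutchinson operator. -/
def Fop (A : Set (EuclideanSpace ℝ (Fin 2))) : Set (EuclideanSpace ℝ (Fin 2)) :=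
  f 0 '' A ∪ f 1 '' A ∪ f 2 '' A

/-- The discrete approximations `A_k = F^{k-1}(A₁)`, `A₁ = {z₀, z₁, z₂}`. -/
def Aset (k : ℕ) : Set (EuclideanSpace ℝ (Fin 2)) := Fop^[k - 1] {z 0, z 1, z 2}

/-- The discrete measures `μ_k`. -/
def muk (k : ℕ) : Measure (EuclideanSpace ℝ (Fin 2)) :=
  ((3 : ℝ≥0∞)⁻¹ ^ k) • ∑ i : Fin (k - 1) → Fin 3,
    (Measure.dirac (fword (List.ofFn i) (z 0)) + Measure.dirac (fword (List.ofFn i) (z 1)) +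
      Measure.dirac (fword (List.ofFn i) (z 2)))

/-- The centred Hausdorff premeasure `C₀^s(A)` (the limit as `δ → 0⁺` is written as a
supremum over `δ > 0`, the inner infimum being antitone in `δ`). -/
def centredPremeasure (s : ℝ) (A : Set (EuclideanSpace ℝ (Fin 2))) : ℝ≥0∞ :=
  ⨆ (δ : ℝ) (_ : 0 < δ),
    ⨅ (x : ℕ → EuclideanSpace ℝ (Fin 2)) (d : ℕ → ℝ) (_ : ∀ n, x n ∈ A)
      (_ : ∀ n, 0 ≤ d n) (_ : ∀ n, 2 * d n ≤ δ) (_ : A ⊆ ⋃ n, closedBall (x n) (d n)),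
      ∑' n, ENNReal.ofReal ((2 * d n) ^ s)

/-- The reflection across the vertical line `x₁ = 1/2`. -/
def refl2 (x : EuclideanSpace ℝ (Fin 2)) : EuclideanSpace ℝ (Fin 2) := pt (1 - x 0) (x 1)

/-- The reflection across the vertical line `x₁ = 1/4`. -/
def refl4 (x : EuclideanSpace ℝ (Fin 2)) : EuclideanSpace ℝ (Fin 2) := pt (1/2 - x 0) (x 1)

/-- The barycentric coordinates with respect to the vertices `z 0, z 1, z 2`. -/
def bary : Fin 3 → EuclideanSpace ℝ (Fin 2) → ℝ
  | 0, x => 1 - x 0 - x 1 / Real.sqrt 3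
  | 1, x => x 0 - x 1 / Real.sqrt 3
  | 2, x => 2 * x 1 / Real.sqrt 3

/-- The point with given barycentric coordinates. -/
def ofBary (β : Fin 3 → ℝ) : EuclideanSpace ℝ (Fin 2) :=
  pt (β 1 + β 2 / 2) (Real.sqrt 3 / 2 * β 2)

@[simp] lemma pt_apply_zero (a b : ℝ) : pt a b 0 = a := rfl

@[simp] lemma pt_apply_one (a b : ℝ) : pt a b 1 = b := rfl

lemma bary_sum (x : EuclideanSpace ℝ (Fin 2)) : bary 0 x + bary 1 x + bary 2 x = 1 := by
  simp only [bary]; ring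

lemma bary_ofBary (β : Fin 3 → ℝ) (h : β 0 + β 1 + β 2 = 1) (i : Fin 3) :
    bary i (ofBary β) = β i := by
  have h3 : Real.sqrt 3 ≠ 0 := by positivity
  fin_cases i <;> simp [bary, ofBary] <;> field_simp <;> linarith

lemma bary_f (i j : Fin 3) (x : EuclideanSpace ℝ (Fin 2)) :
    bary i (f j x) = (bary i x + if i = j then 1 else 0) / 2 := by
  have h3 : Real.sqrt 3 ≠ 0 := by positivity
  fin_cases i <;> fin_cases j <;> simp [bary, f, v] <;> field_simp <;> ring

lemma bary_z (i j : Fin 3) : bary i (z j) = if i = j then 1 else 0 := by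
  have h3 : Real.sqrt 3 ≠ 0 := by positivity
  fin_cases i <;> fin_cases j <;> simp [bary, z, v] <;> field_simp <;> norm_num

lemma dist_sq_eq_bary (x y : EuclideanSpace ℝ (Fin 2)) :
    dist x y ^ 2 = (∑ i, (bary i x - bary i y) ^ 2) / 2 := by
  have h3 : Real.sqrt 3 ≠ 0 := by positivity
  have h4 : Real.sqrt 3 ^ 2 = 3 := Real.sq_sqrt (by norm_num)
  rw [EuclideanSpace.dist_eq, Real.sq_sqrt (by positivity), Fin.sum_univ_two, Fin.sum_univ_three,
    Real.dist_eq, Real.dist_eq, sq_abs, sq_abs]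
  simp only [bary]
  field_simp
  ring_nf
  rw [h4]
  ring

lemma eq_of_bary_eq {x y : EuclideanSpace ℝ (Fin 2)} (h : ∀ i, bary i x = bary i y) : x = y := by
  have := dist_sq_eq_bary x y
  simp only [h, sub_self] at this
  simpa using this

lemma abs_bary_sub_lt {x y : EuclideanSpace ℝ (Fin 2)} {t : ℝ}
    (h : dist x y < Real.sqrt 3 / 2 * t) (i : Fin 3) : |bary i x - bary i y| < t := by
  have h0 := dist_sq_eq_bary x y
  have ht : 0 < t := by
    have h3 : 0 < Real.sqrt 3 / 2 := by positivity
    exact pos_of_mul_pos_right (dist_nonneg.trans_lt h) h3.le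
  have h1 : dist x y ^ 2 < 3 / 4 * t ^ 2 := by
    calc dist x y ^ 2 < (Real.sqrt 3 / 2 * t) ^ 2 := by gcongr
      _ = 3 / 4 * t ^ 2 := by rw [mul_pow, div_pow, Real.sq_sqrt (by norm_num)]; norm_num
  have hx := bary_sum x
  have hy := bary_sum y
  rw [h0, Fin.sum_univ_three] at h1
  have h2 : bary 2 x - bary 2 y = -(bary 0 x - bary 0 y) - (bary 1 x - bary 1 y) := by linarith
  refine abs_lt_of_sq_lt_sq ?_ ht.le
  set p := bary 0 x - bary 0 y
  set q := bary 1 x - bary 1 y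
  fin_cases i <;> simp only [Fin.zero_eta, Fin.mk_one, Fin.reduceFinMk] <;> rw [h2] at h1
  · nlinarith [sq_nonneg (p + 2 * q)]
  · nlinarith [sq_nonneg (q + 2 * p)]
  · rw [h2]; nlinarith [sq_nonneg (p - q)]

lemma continuous_bary (i : Fin 3) : Continuous (bary i) := by
  fin_cases i
  · exact (by fun_prop : Continuous fun x : EuclideanSpace ℝ (Fin 2) =>
      1 - x 0 - x 1 / Real.sqrt 3)
  · exact (by fun_prop : Continuous fun x : EuclideanSpace ℝ (Fin 2) => x 0 - x 1 / Real.sqrt 3)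
  · exact (by fun_prop : Continuous fun x : EuclideanSpace ℝ (Fin 2) => 2 * x 1 / Real.sqrt 3)

lemma dist_f (i : Fin 3) (x y : EuclideanSpace ℝ (Fin 2)) :
    dist (f i x) (f i y) = dist x y / 2 := by
  simp only [f, dist_add_right, dist_smul₀]
  norm_num
  ring

lemma f_z_self (i : Fin 3) : f i (z i) = z i := by
  simp only [f, z, smul_smul]
  norm_num [two_smul]

lemma f_z_comm (i j : Fin 3) : f i (z j) = f j (z i) := by
  simp only [f, z, smul_smul]
  norm_num [add_comm]

/-- A compact set contained in the union of its images lies in every nonempty closed set mapped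
into itself by the similitudes. -/
lemma subset_of_mapsTo {S T : Set (EuclideanSpace ℝ (Fin 2))} (hS : IsCompact S)
    (hSinv : ∀ x ∈ S, ∃ i, ∃ y ∈ S, f i y = x) (hT : IsClosed T) (hTne : T.Nonempty)
    (hTinv : ∀ i, ∀ x ∈ T, f i x ∈ T) : S ⊆ T := by
  intro x hx
  obtain ⟨m, hm, hmax⟩ := hS.exists_isMaxOn ⟨x, hx⟩ (continuous_infDist_pt T).continuousOn
  obtain ⟨i, y, hy, rfl⟩ := hSinv m hm
  have h1 : infDist (f i y) T ≤ infDist y T / 2 := by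
    obtain ⟨t, ht, hty⟩ := hT.exists_infDist_eq_dist hTne y
    calc infDist (f i y) T ≤ dist (f i y) (f i t) := infDist_le_dist_of_mem (hTinv i t ht)
      _ = infDist y T / 2 := by rw [dist_f, hty]
  have h2 : infDist y T ≤ infDist (f i y) T := hmax hy
  have h3 : infDist x T ≤ infDist (f i y) T := hmax hx
  rw [hT.mem_iff_infDist_zero hTne]
  exact le_antisymm (by linarith) infDist_nonneg

/-- The isometry permuting the barycentric coordinates. -/
def permute (σ : Equiv.Perm (Fin 3)) (x : EuclideanSpace ℝ (Fin 2)) : EuclideanSpace ℝ (Fin 2) :=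
  ofBary fun i => bary (σ i) x

lemma bary_permute (σ : Equiv.Perm (Fin 3)) (x : EuclideanSpace ℝ (Fin 2)) (i : Fin 3) :
    bary i (permute σ x) = bary (σ i) x := by
  refine bary_ofBary _ ?_ i
  have h := Equiv.sum_comp σ fun i => bary i x
  rw [Fin.sum_univ_three, Fin.sum_univ_three] at h
  rw [h, bary_sum]

lemma isometry_permute (σ : Equiv.Perm (Fin 3)) : Isometry (permute σ) := by
  refine Isometry.of_dist_eq fun x y => ?_
  rw [← sq_eq_sq₀ dist_nonneg dist_nonneg, dist_sq_eq_bary, dist_sq_eq_bary]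
  simp only [bary_permute]
  rw [Equiv.sum_comp σ fun i => (bary i x - bary i y) ^ 2]

lemma permute_f (σ : Equiv.Perm (Fin 3)) (j : Fin 3) (x : EuclideanSpace ℝ (Fin 2)) :
    permute σ (f (σ j) x) = f j (permute σ x) := by
  refine eq_of_bary_eq fun i => ?_
  simp only [bary_permute, bary_f, σ.injective.eq_iff]

/-- Nonempty compact invariant sets of the three similitudes. -/
structure IsGasket (S : Set (EuclideanSpace ℝ (Fin 2))) : Prop where
  isCompact : IsCompact S
  nonempty : S.Nonempty
  eq_union : S = f 0 '' S ∪ f 1 '' S ∪ f 2 '' S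

namespace IsGasket

variable {S : Set (EuclideanSpace ℝ (Fin 2))}

lemma exists_f_eq (hS : IsGasket S) {x : EuclideanSpace ℝ (Fin 2)} (hx : x ∈ S) :
    ∃ i, ∃ y ∈ S, f i y = x := by
  rw [hS.eq_union] at hx
  obtain (hx | hx) | hx := hx
  · exact ⟨0, hx⟩
  · exact ⟨1, hx⟩
  · exact ⟨2, hx⟩

lemma f_mem (hS : IsGasket S) (i : Fin 3) {x : EuclideanSpace ℝ (Fin 2)} (hx : x ∈ S) :
    f i x ∈ S := by
  rw [hS.eq_union]
  fin_cases i
  · exact Or.inl (Or.inl ⟨x, hx, rfl⟩)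
  · exact Or.inl (Or.inr ⟨x, hx, rfl⟩)
  · exact Or.inr ⟨x, hx, rfl⟩

lemma fword_mem (hS : IsGasket S) (l : List (Fin 3)) {x : EuclideanSpace ℝ (Fin 2)} (hx : x ∈ S) :
    fword l x ∈ S := by
  induction l with
  | nil => exact hx
  | cons i l ih => exact hS.f_mem i ih

lemma subset (hS : IsGasket S) {T : Set (EuclideanSpace ℝ (Fin 2))} (hT : IsClosed T)
    (hTne : T.Nonempty) (hTinv : ∀ i, ∀ x ∈ T, f i x ∈ T) : S ⊆ T :=
  subset_of_mapsTo hS.isCompact (fun _ hx => hS.exists_f_eq hx) hT hTne hTinv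

lemma z_mem (hS : IsGasket S) (i : Fin 3) : z i ∈ S := by
  have h : ({z i} : Set (EuclideanSpace ℝ (Fin 2))) ⊆ S := by
    refine subset_of_mapsTo isCompact_singleton ?_ hS.isCompact.isClosed hS.nonempty
      fun j x hx => hS.f_mem j hx
    rintro x rfl
    exact ⟨i, z i, rfl, f_z_self i⟩
  exact h rfl

lemma bary_nonneg (hS : IsGasket S) {x : EuclideanSpace ℝ (Fin 2)} (hx : x ∈ S) (i : Fin 3) :
    0 ≤ bary i x := by
  have h : S ⊆ {x | 0 ≤ bary i x} := by
    refine hS.subset (isClosed_le continuous_const (continuous_bary i)) ⟨z i, by simp [bary_z]⟩ ?_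
    intro j x hx
    simp only [mem_ofPred_eq, bary_f] at hx ⊢
    split_ifs <;> linarith
  exact h hx

lemma bary_add_le (hS : IsGasket S) {x : EuclideanSpace ℝ (Fin 2)} (hx : x ∈ S) {i j : Fin 3}
    (hij : i ≠ j) : bary i x + bary j x ≤ 1 := by
  have h := bary_sum x
  have h0 := hS.bary_nonneg hx 0
  have h1 := hS.bary_nonneg hx 1
  have h2 := hS.bary_nonneg hx 2
  fin_cases i <;> fin_cases j <;> simp at hij ⊢ <;> linarith

lemma permute_mem (hS : IsGasket S) (σ : Equiv.Perm (Fin 3)) {x : EuclideanSpace ℝ (Fin 2)}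
    (hx : x ∈ S) : permute σ x ∈ S := by
  have h : S ⊆ permute σ ⁻¹' S := by
    refine hS.subset (hS.isCompact.isClosed.preimage (isometry_permute σ).continuous) ?_ ?_
    · obtain ⟨y, hy⟩ := hS.nonempty
      refine ⟨permute σ⁻¹ y, ?_⟩
      rw [mem_preimage, eq_of_bary_eq (x := permute σ (permute σ⁻¹ y)) (y := y) fun i => ?_]
      · exact hy
      · simp [bary_permute]
    · intro i x hx
      rw [mem_preimage, ← σ.apply_symm_apply i, permute_f]
      exact hS.f_mem _ hx
  exact h hx

lemma dist_z_le_one (hS : IsGasket S) {x : EuclideanSpace ℝ (Fin 2)} (hx : x ∈ S) (j : Fin 3) :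
    dist x (z j) ≤ 1 := by
  have h := bary_sum x
  have h0 := hS.bary_nonneg hx 0
  have h1 := hS.bary_nonneg hx 1
  have h2 := hS.bary_nonneg hx 2
  have hd := dist_sq_eq_bary x (z j)
  rw [Fin.sum_univ_three] at hd
  have h3 : bary 0 x = 1 - bary 1 x - bary 2 x := by linarith
  suffices dist x (z j) ^ 2 ≤ 1 from (sq_le_one_iff₀ dist_nonneg).1 this
  rw [hd]
  fin_cases j <;> simp [bary_z] <;>
    nlinarith [mul_nonneg h0 h1, mul_nonneg h0 h2, mul_nonneg h1 h2]

end IsGasket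

lemma sDim_pos : 0 < sDim := div_pos (Real.log_pos (by norm_num)) (Real.log_pos (by norm_num))

lemma two_rpow_sDim : (2 : ℝ) ^ sDim = 3 := by
  rw [sDim, Real.rpow_def_of_pos (by norm_num), mul_div_cancel₀ _ (Real.log_pos (by norm_num)).ne',
    Real.exp_log (by norm_num)]

lemma ofReal_two_mul_rpow_sDim {r : ℝ} (hr : 0 ≤ r) :
    ENNReal.ofReal ((2 * r) ^ sDim) = 3 * ENNReal.ofReal (r ^ sDim) := by
  rw [Real.mul_rpow (by norm_num) hr, two_rpow_sDim, ENNReal.ofReal_mul (by norm_num)]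
  norm_num

/-- The cheapest centred ball of diameter at most `δ` covering a set. -/
def ballCost (S : Set (EuclideanSpace ℝ (Fin 2))) (δ : ℝ) (A : Set (EuclideanSpace ℝ (Fin 2))) :
    ℝ≥0∞ :=
  ⨅ (x : EuclideanSpace ℝ (Fin 2)) (r : ℝ) (_ : x ∈ S) (_ : 0 ≤ r) (_ : 2 * r ≤ δ)
    (_ : A ⊆ closedBall x r), ENNReal.ofReal ((2 * r) ^ sDim)

lemma ballCost_le {S A : Set (EuclideanSpace ℝ (Fin 2))} {δ r : ℝ} {x : EuclideanSpace ℝ (Fin 2)}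
    (hx : x ∈ S) (hr : 0 ≤ r) (hrδ : 2 * r ≤ δ) (hA : A ⊆ closedBall x r) :
    ballCost S δ A ≤ ENNReal.ofReal ((2 * r) ^ sDim) :=
  iInf₂_le_of_le x r <| iInf₂_le_of_le hx hr <| iInf₂_le hrδ hA

namespace IsGasket

variable {S : Set (EuclideanSpace ℝ (Fin 2))}

lemma ballCost_empty (hS : IsGasket S) {δ : ℝ} (hδ : 0 < δ) : ballCost S δ ∅ = 0 := by
  obtain ⟨x, hx⟩ := hS.nonempty
  refine le_antisymm ((ballCost_le hx le_rfl (by simpa using hδ.le) (empty_subset _)).trans ?_)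
    zero_le
  simp [Real.zero_rpow sDim_pos.ne']

/-- The outer measure whose value is the infimum of the costs of coverings by balls centred
in `S` with diameter at most `δ`. -/
def coverMeasure (hS : IsGasket S) {δ : ℝ} (hδ : 0 < δ) :
    OuterMeasure (EuclideanSpace ℝ (Fin 2)) :=
  OuterMeasure.ofFunction (ballCost S δ) (hS.ballCost_empty hδ)

lemma iInf_cover_le_coverMeasure (hS : IsGasket S) {δ : ℝ} (hδ : 0 < δ) :
    (⨅ (x : ℕ → EuclideanSpace ℝ (Fin 2)) (d : ℕ → ℝ) (_ : ∀ n, x n ∈ S)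
      (_ : ∀ n, 0 ≤ d n) (_ : ∀ n, 2 * d n ≤ δ) (_ : S ⊆ ⋃ n, closedBall (x n) (d n)),
      ∑' n, ENNReal.ofReal ((2 * d n) ^ sDim)) ≤ hS.coverMeasure hδ S := by
  rw [coverMeasure, OuterMeasure.ofFunction_apply]
  refine le_iInf₂ fun t ht => ENNReal.le_of_forall_pos_le_add fun ε hε hfin => ?_
  obtain ⟨ε', hε', hsum⟩ := ENNReal.exists_pos_sum_of_countable (ENNReal.coe_pos.2 hε).ne' ℕ
  have key : ∀ n, ∃ x r, x ∈ S ∧ 0 ≤ r ∧ 2 * r ≤ δ ∧ t n ⊆ closedBall x r ∧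
      ENNReal.ofReal ((2 * r) ^ sDim) < ballCost S δ (t n) + ε' n := by
    intro n
    have h : ballCost S δ (t n) < ballCost S δ (t n) + ε' n :=
      ENNReal.lt_add_right (ENNReal.ne_top_of_tsum_ne_top hfin.ne n) (by simpa using (hε' n).ne')
    conv_lhs at h => unfold ballCost
    simpa only [iInf_lt_iff, exists_prop] using h
  choose x r hx hr hrδ htr hlt using key
  calc _ ≤ ∑' n, ENNReal.ofReal ((2 * r n) ^ sDim) :=
        iInf₂_le_of_le x r <| iInf₂_le_of_le hx hr <| iInf₂_le hrδ <|
          ht.trans (iUnion_mono htr)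
    _ ≤ ∑' n, (ballCost S δ (t n) + ε' n) := ENNReal.tsum_le_tsum fun n => (hlt n).le
    _ = ∑' n, ballCost S δ (t n) + ∑' n, (ε' n : ℝ≥0∞) := ENNReal.tsum_add
    _ ≤ _ := by gcongr

lemma coverMeasure_image_f_le (hS : IsGasket S) {δ : ℝ} (hδ : 0 < δ) (i : Fin 3)
    (A : Set (EuclideanSpace ℝ (Fin 2))) :
    3 * hS.coverMeasure hδ (f i '' A) ≤ hS.coverMeasure (δ := 2 * δ) (by positivity) A := by
  have h : (3 : ℝ≥0∞) • OuterMeasure.comap (f i) (hS.coverMeasure hδ) ≤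
      hS.coverMeasure (δ := 2 * δ) (by positivity) := by
    refine OuterMeasure.le_ofFunction.2 fun T => ?_
    simp only [_root_.smul_apply, OuterMeasure.comap_apply, smul_eq_mul]
    refine le_iInf₂ fun x r => le_iInf₂ fun hx hr => le_iInf₂ fun hrδ hT => ?_
    rw [ofReal_two_mul_rpow_sDim hr]
    gcongr
    refine (OuterMeasure.ofFunction_le _).trans ?_
    have hT' : f i '' T ⊆ closedBall (f i x) (r / 2) := by
      rintro _ ⟨y, hy, rfl⟩
      rw [mem_closedBall, dist_f]
      have := mem_closedBall.1 (hT hy)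
      linarith
    refine (ballCost_le (hS.f_mem i hx) (by positivity) (by linarith) hT').trans_eq ?_
    rw [mul_div_cancel₀ _ two_ne_zero]
  simpa using h A

lemma coverMeasure_anti (hS : IsGasket S) {δ ε : ℝ} (hδ : 0 < δ) (h : δ ≤ ε) :
    hS.coverMeasure (hδ.trans_le h) ≤ hS.coverMeasure hδ := by
  refine OuterMeasure.le_ofFunction.2 fun T => (OuterMeasure.ofFunction_le T).trans ?_
  exact le_iInf₂ fun x r => le_iInf₂ fun hx hr => le_iInf₂ fun hrδ hT =>
    ballCost_le hx hr (hrδ.trans h) hT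

lemma coverMeasure_two_mul (hS : IsGasket S) {δ : ℝ} (hδ : 0 < δ) :
    hS.coverMeasure hδ S ≤ hS.coverMeasure (δ := 2 * δ) (by positivity) S := by
  have h3 : hS.coverMeasure hδ S ≤ hS.coverMeasure hδ (f 0 '' S) + hS.coverMeasure hδ (f 1 '' S) +
      hS.coverMeasure hδ (f 2 '' S) := by
    refine (measure_mono hS.eq_union.subset).trans ?_
    exact (measure_union_le _ _).trans (add_le_add_left (measure_union_le _ _) _)
  have h : 3 * hS.coverMeasure hδ S ≤ 3 * hS.coverMeasure (δ := 2 * δ) (by positivity) S := by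
    calc 3 * hS.coverMeasure hδ S ≤ 3 * _ := mul_le_mul_right h3 3
      _ = 3 * hS.coverMeasure hδ (f 0 '' S) + 3 * hS.coverMeasure hδ (f 1 '' S) +
          3 * hS.coverMeasure hδ (f 2 '' S) := by ring
      _ ≤ _ := add_le_add_three (hS.coverMeasure_image_f_le hδ 0 S)
        (hS.coverMeasure_image_f_le hδ 1 S) (hS.coverMeasure_image_f_le hδ 2 S)
      _ = _ := by ring
  rwa [ENNReal.mul_le_mul_iff_right (by norm_num) (by norm_num)] at h

lemma coverMeasure_le (hS : IsGasket S) {δ ε : ℝ} (hδ : 0 < δ) (hε : 0 < ε) :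
    hS.coverMeasure hδ S ≤ hS.coverMeasure hε S := by
  have h : ∀ n : ℕ, hS.coverMeasure hδ S ≤
      hS.coverMeasure (δ := 2 ^ n * δ) (by positivity) S := by
    intro n
    induction n with
    | zero => simp
    | succ n ih =>
      refine ih.trans ((hS.coverMeasure_two_mul (δ := 2 ^ n * δ) (by positivity)).trans_eq ?_)
      congr 2
      ring
  obtain ⟨n, hn⟩ := pow_unbounded_of_one_lt (ε / δ) (one_lt_two (α := ℝ))
  refine (h n).trans (hS.coverMeasure_anti hε ?_ S)
  rw [div_lt_iff₀ hδ] at hn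
  exact hn.le

lemma coverMeasure_lt_top (hS : IsGasket S) {δ : ℝ} (hδ : 0 < δ) : hS.coverMeasure hδ S < ⊤ := by
  refine (hS.coverMeasure_le hδ (ε := 2) two_pos).trans_lt ?_
  refine ((OuterMeasure.ofFunction_le S).trans (ballCost_le (hS.z_mem 0) zero_le_one
    (by norm_num) fun x hx => hS.dist_z_le_one hx 0)).trans_lt ENNReal.ofReal_lt_top

lemma coverMeasure_image_fword_le (hS : IsGasket S) {δ : ℝ} (hδ : 0 < δ) (l : List (Fin 3)) :
    3 ^ l.length * hS.coverMeasure hδ (fword l '' S) ≤ hS.coverMeasure hδ S := by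
  induction l generalizing δ with
  | nil => simp [fword]
  | cons i l ih =>
    rw [List.length_cons, fword, image_comp, pow_succ, mul_assoc]
    calc _ ≤ 3 ^ l.length * hS.coverMeasure (δ := 2 * δ) (by positivity) (fword l '' S) := by
          gcongr
          exact hS.coverMeasure_image_f_le hδ i _
      _ ≤ _ := (ih _).trans (hS.coverMeasure_le _ _)

lemma exists_fword_ofFn_eq (hS : IsGasket S) (n : ℕ) {x : EuclideanSpace ℝ (Fin 2)} (hx : x ∈ S) :
    ∃ i : Fin n → Fin 3, ∃ y ∈ S, fword (List.ofFn i) y = x := by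
  induction n generalizing x with
  | zero => exact ⟨Fin.elim0, x, hx, by simp [fword]⟩
  | succ n ih =>
    obtain ⟨j, y, hy, rfl⟩ := hS.exists_f_eq hx
    obtain ⟨i, w, hw, rfl⟩ := ih hy
    exact ⟨Fin.cons j i, w, hw, by simp [List.ofFn_succ, fword]⟩

/-- The cell of level `n + 1` with marked corner `fword (List.ofFn p.1) (z p.2)`. -/
lemma exists_cell (hS : IsGasket S) (n : ℕ) {x : EuclideanSpace ℝ (Fin 2)} (hx : x ∈ S) :
    ∃ p : (Fin n → Fin 3) × Fin 3, x ∈ fword (List.ofFn p.1) '' (f p.2 '' S) := by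
  obtain ⟨i, y, hy, rfl⟩ := hS.exists_fword_ofFn_eq n hx
  obtain ⟨j, w, hw, rfl⟩ := hS.exists_f_eq hy
  exact ⟨(i, j), _, ⟨w, hw, rfl⟩, rfl⟩

end IsGasket

lemma dist_fword (l : List (Fin 3)) (x y : EuclideanSpace ℝ (Fin 2)) :
    dist (fword l x) (fword l y) = dist x y / 2 ^ l.length := by
  induction l with
  | nil => simp [fword]
  | cons i l ih =>
    rw [List.length_cons, fword, Function.comp_apply, Function.comp_apply, dist_f, ih, pow_succ,
      div_div]

lemma fword_append (l m : List (Fin 3)) : fword (l ++ m) = fword l ∘ fword m := by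
  induction l with
  | nil => rfl
  | cons i l ih => simp only [List.cons_append, fword, ih]; rfl

lemma IsGasket.dist_corner_le {S : Set (EuclideanSpace ℝ (Fin 2))} (hS : IsGasket S) {n : ℕ}
    {p : (Fin n → Fin 3) × Fin 3} {x : EuclideanSpace ℝ (Fin 2)}
    (hx : x ∈ fword (List.ofFn p.1) '' (f p.2 '' S)) :
    dist x (fword (List.ofFn p.1) (z p.2)) ≤ (2 ^ (n + 1))⁻¹ := by
  obtain ⟨_, ⟨y, hy, rfl⟩, rfl⟩ := hx
  rw [dist_fword, ← f_z_self p.2, dist_f, List.length_ofFn, pow_succ', div_div,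
    ← one_div]
  gcongr
  exact hS.dist_z_le_one hy _

open Classical in
lemma muk_succ_apply (n : ℕ) {A : Set (EuclideanSpace ℝ (Fin 2))} (hA : MeasurableSet A) :
    muk (n + 1) A = ∑ p : (Fin n → Fin 3) × Fin 3,
      if fword (List.ofFn p.1) (z p.2) ∈ A then (3 ^ (n + 1) : ℝ≥0∞)⁻¹ else 0 := by
  simp only [muk, Nat.add_sub_cancel, Measure.smul_apply, Measure.finsetSum_apply,
    Measure.add_apply, Measure.dirac_apply' _ hA, smul_eq_mul, Finset.mul_sum, Fintype.sum_prod_type,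
    Fin.sum_univ_three, mul_add, ENNReal.inv_pow, indicator_apply, mul_ite, mul_zero, Pi.one_apply,
    mul_one]
  rfl

/-- The level-`(n + 1)` cells whose marked corner lies in the ball `B(x, d - 2^{-(n+1)})` are
covered by `B(x, d)`, so each of them is saved from an optimal covering. -/
lemma IsGasket.coverMeasure_mul_muk_le {S : Set (EuclideanSpace ℝ (Fin 2))} (hS : IsGasket S)
    (n : ℕ) {x : EuclideanSpace ℝ (Fin 2)} (hx : x ∈ S) {d : ℝ} (hd : 0 < d) {δ : ℝ} (hδ : 0 < δ) :
    hS.coverMeasure hδ S * muk (n + 1) (closedBall x (d - (2 ^ (n + 1))⁻¹)) ≤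
      ENNReal.ofReal ((2 * d) ^ sDim) := by
  classical
  have hd2 : 0 < 2 * d := by positivity
  set Φ := hS.coverMeasure hd2
  set cell : (Fin n → Fin 3) × Fin 3 → Set (EuclideanSpace ℝ (Fin 2)) :=
    fun p => fword (List.ofFn p.1) '' (f p.2 '' S)
  set P : (Fin n → Fin 3) × Fin 3 → Prop :=
    fun p => fword (List.ofFn p.1) (z p.2) ∈ closedBall x (d - (2 ^ (n + 1))⁻¹)
  have hcell : ∀ p, Φ (cell p) ≤ Φ S * (3 ^ (n + 1) : ℝ≥0∞)⁻¹ := by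
    intro p
    have h := hS.coverMeasure_image_fword_le hd2 (List.ofFn p.1 ++ [p.2])
    rw [fword_append, image_comp] at h
    simp only [List.length_append, List.length_ofFn, List.length_singleton] at h
    rw [← div_eq_mul_inv, ENNReal.le_div_iff_mul_le (by simp) (by simp), mul_comm]
    exact h
  have hmuk : muk (n + 1) (closedBall x (d - (2 ^ (n + 1))⁻¹)) =
      ∑ p, if P p then (3 ^ (n + 1) : ℝ≥0∞)⁻¹ else 0 := muk_succ_apply n measurableSet_closedBall
  have hsplit : (∑ p, if P p then (3 ^ (n + 1) : ℝ≥0∞)⁻¹ else 0) +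
      (∑ p, if P p then 0 else (3 ^ (n + 1) : ℝ≥0∞)⁻¹) = 1 := by
    rw [← Finset.sum_add_distrib]
    have : ∀ p, ((if P p then (3 ^ (n + 1) : ℝ≥0∞)⁻¹ else 0) +
        if P p then 0 else (3 ^ (n + 1) : ℝ≥0∞)⁻¹) = (3 ^ (n + 1) : ℝ≥0∞)⁻¹ := by
      intro p; split_ifs <;> simp
    simp only [this, Finset.sum_const, Finset.card_univ, Fintype.card_prod, Fintype.card_pi,
      Fintype.card_fin, Finset.prod_const, nsmul_eq_mul]
    rw [← pow_succ]
    push_cast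
    exact ENNReal.mul_inv_cancel (by simp) (by simp)
  have hsub : S ⊆ closedBall x d ∪ ⋃ p, if P p then ∅ else cell p := by
    intro y hy
    obtain ⟨p, hp⟩ := hS.exists_cell n hy
    by_cases hP : P p
    · left
      have h1 := hS.dist_corner_le hp
      have h2 := mem_closedBall.1 hP
      have h3 := dist_triangle y (fword (List.ofFn p.1) (z p.2)) x
      rw [mem_closedBall]
      linarith
    · exact Or.inr (mem_iUnion.2 ⟨p, by rwa [if_neg hP]⟩)
  have hball : Φ (closedBall x d) ≤ ENNReal.ofReal ((2 * d) ^ sDim) :=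
    (OuterMeasure.ofFunction_le _).trans (ballCost_le hx hd.le le_rfl subset_rfl)
  have hfin : Φ S ≠ ⊤ := (hS.coverMeasure_lt_top hd2).ne
  have hle : Φ S ≤ ENNReal.ofReal ((2 * d) ^ sDim) +
      Φ S * ∑ p, if P p then 0 else (3 ^ (n + 1) : ℝ≥0∞)⁻¹ := by
    calc Φ S ≤ Φ (closedBall x d) + Φ (⋃ p, if P p then ∅ else cell p) :=
          (measure_mono hsub).trans (measure_union_le _ _)
      _ ≤ _ := by
        gcongr
        refine (measure_iUnion_fintype_le Φ _).trans ?_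
        rw [Finset.mul_sum]
        gcongr with p
        split_ifs
        · simp
        · exact hcell p
  have hne : Φ S * ∑ p, (if P p then 0 else (3 ^ (n + 1) : ℝ≥0∞)⁻¹) ≠ ⊤ :=
    ENNReal.mul_ne_top hfin (ne_top_of_le_ne_top ENNReal.one_ne_top (hsplit ▸ le_add_self))
  refine (mul_le_mul_left (hS.coverMeasure_le hδ hd2) _).trans ?_
  rw [hmuk, ← ENNReal.add_le_add_iff_right hne, ← mul_add, hsplit, mul_one]
  exact hle

lemma IsGasket.centredPremeasure_le {S : Set (EuclideanSpace ℝ (Fin 2))} (hS : IsGasket S)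
    (n : ℕ) {x : EuclideanSpace ℝ (Fin 2)} (hx : x ∈ S) {d : ℝ} (hd : 0 < d) :
    centredPremeasure sDim S ≤ ENNReal.ofReal ((2 * d) ^ sDim) /
      muk (n + 1) (closedBall x (d - (2 ^ (n + 1))⁻¹)) := by
  refine iSup₂_le fun δ hδ => (hS.iInf_cover_le_coverMeasure hδ).trans ?_
  rw [ENNReal.le_div_iff_mul_le (Or.inr (by simp; positivity)) (Or.inr ENNReal.ofReal_ne_top)]
  exact hS.coverMeasure_mul_muk_le n hx hd hδ

lemma hausdorffMeasure_image_le_div_three {g : EuclideanSpace ℝ (Fin 2) → EuclideanSpace ℝ (Fin 2)}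
    (hg : ∀ x y, dist (g x) (g y) = dist x y / 2) (A : Set (EuclideanSpace ℝ (Fin 2))) :
    3 * μH[sDim] (g '' A) ≤ μH[sDim] A := by
  have hL : LipschitzWith (1 / 2) g := LipschitzWith.of_dist_le_mul fun x y => by
    rw [hg]; push_cast; linarith
  have h := hL.hausdorffMeasure_image_le sDim_pos.le A
  have h3 : (3 : ℝ≥0∞) * ((1 / 2 : NNReal) : ℝ≥0∞) ^ sDim = 1 := by
    have : (3 : ℝ≥0∞) = 2 ^ sDim := by
      rw [← ENNReal.ofReal_ofNat 2, ENNReal.ofReal_rpow_of_pos (by norm_num), two_rpow_sDim]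
      simp
    rw [this, ← ENNReal.mul_rpow_of_nonneg _ _ sDim_pos.le]
    simp [ENNReal.mul_inv_cancel]
  calc 3 * μH[sDim] (g '' A) ≤ 3 * _ := mul_le_mul_right h 3
    _ = μH[sDim] A := by rw [← mul_assoc, h3, one_mul]

lemma hausdorffMeasure_image_fword_le (l : List (Fin 3)) (A : Set (EuclideanSpace ℝ (Fin 2))) :
    3 ^ l.length * μH[sDim] (fword l '' A) ≤ μH[sDim] A := by
  induction l with
  | nil => simp [fword]
  | cons i l ih =>
    rw [List.length_cons, fword, image_comp, pow_succ, mul_assoc]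
    exact (mul_le_mul_right (hausdorffMeasure_image_le_div_three (dist_f i) _) _).trans ih

/-- Moving the mass of each cell of level `n + 1` to its marked corner. -/
lemma IsGasket.hausdorffMeasure_inter_closedBall_le {S : Set (EuclideanSpace ℝ (Fin 2))}
    (hS : IsGasket S) (n : ℕ) (x : EuclideanSpace ℝ (Fin 2)) (d : ℝ) :
    μH[sDim] (S ∩ closedBall x d) ≤
      muk (n + 1) (closedBall x (d + (2 ^ (n + 1))⁻¹)) * μH[sDim] S := by
  classical
  rw [muk_succ_apply n measurableSet_closedBall, Finset.sum_mul]
  have hsub : S ∩ closedBall x d ⊆ ⋃ p : (Fin n → Fin 3) × Fin 3,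
      if fword (List.ofFn p.1) (z p.2) ∈ closedBall x (d + (2 ^ (n + 1))⁻¹) then
        fword (List.ofFn p.1) '' (f p.2 '' S) else ∅ := by
    rintro y ⟨hyS, hy⟩
    obtain ⟨p, hp⟩ := hS.exists_cell n hyS
    refine mem_iUnion.2 ⟨p, ?_⟩
    rwa [if_pos]
    have h1 := hS.dist_corner_le hp
    rw [mem_closedBall] at hy ⊢
    have h3 := dist_triangle_left (fword (List.ofFn p.1) (z p.2)) x y
    linarith
  refine (measure_mono hsub).trans ((measure_iUnion_fintype_le _ _).trans ?_)
  gcongr with p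
  split_ifs
  · have h := hausdorffMeasure_image_fword_le (List.ofFn p.1 ++ [p.2]) S
    rw [fword_append, image_comp] at h
    simp only [List.length_append, List.length_ofFn, List.length_singleton] at h
    rw [mul_comm, ← div_eq_mul_inv, ENNReal.le_div_iff_mul_le (by simp) (by simp), mul_comm]
    exact h
  · simp

lemma Aset_succ (n : ℕ) : Aset (n + 2) = Fop (Aset (n + 1)) := Function.iterate_succ_apply' ..

lemma z_mem_Aset_one (j : Fin 3) : z j ∈ Aset 1 := by
  fin_cases j <;> simp [Aset]

lemma f_mem_Aset {n : ℕ} (i : Fin 3) {x : EuclideanSpace ℝ (Fin 2)} (hx : x ∈ Aset (n + 1)) :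
    f i x ∈ Aset (n + 2) := by
  rw [Aset_succ]
  fin_cases i
  · exact Or.inl (Or.inl ⟨x, hx, rfl⟩)
  · exact Or.inl (Or.inr ⟨x, hx, rfl⟩)
  · exact Or.inr ⟨x, hx, rfl⟩

lemma fword_z_mem_Aset (l : List (Fin 3)) (j : Fin 3) : fword l (z j) ∈ Aset (l.length + 1) := by
  induction l with
  | nil => exact z_mem_Aset_one j
  | cons i l ih => exact f_mem_Aset i ih

lemma z_mem_Aset (n : ℕ) (j : Fin 3) : z j ∈ Aset (n + 1) := by
  induction n with
  | zero => exact z_mem_Aset_one j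
  | succ n ih => exact f_z_self j ▸ f_mem_Aset j ih

lemma finite_Aset (n : ℕ) : (Aset (n + 1)).Finite := by
  induction n with
  | zero => simp [Aset]
  | succ n ih =>
    rw [Aset_succ]
    exact ((ih.image _).union (ih.image _)).union (ih.image _)

lemma dist_z_le_one (i j : Fin 3) : dist (z i) (z j) ≤ 1 := by
  have hd := dist_sq_eq_bary (z i) (z j)
  rw [Fin.sum_univ_three] at hd
  refine (sq_le_one_iff₀ dist_nonneg).1 ?_
  rw [hd]
  fin_cases i <;> fin_cases j <;> simp [bary_z]

/-- The vertices of level `n + 1` are connected through steps of length `2^{-n}`. -/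
lemma Aset_subset_of_step (n : ℕ) (P : Set (EuclideanSpace ℝ (Fin 2))) (h0 : z 0 ∈ P)
    (hstep : ∀ a ∈ Aset (n + 1), ∀ b ∈ Aset (n + 1), a ∈ P → dist a b ≤ (2 ^ n)⁻¹ → b ∈ P) :
    Aset (n + 1) ⊆ P := by
  induction n generalizing P with
  | zero =>
    intro x hx
    have hx' : x = z 0 ∨ x = z 1 ∨ x = z 2 := hx
    obtain rfl | rfl | rfl := hx' <;>
      exact hstep (z 0) (z_mem_Aset 0 0) _ hx h0 (by simp [dist_z_le_one])
  | succ n ih =>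
    have key : ∀ i, f i (z 0) ∈ P → ∀ x ∈ Aset (n + 1), f i x ∈ P := by
      intro i hi
      refine ih (f i ⁻¹' P) hi fun a ha b hb haP hab => ?_
      refine hstep _ (f_mem_Aset i ha) _ (f_mem_Aset i hb) haP ?_
      rw [dist_f, pow_succ, mul_inv]
      linarith
    have hz : ∀ i, f 0 (z i) ∈ P := fun i => key 0 ((f_z_self 0).symm ▸ h0) _ (z_mem_Aset n i)
    intro x hx
    rw [Aset_succ] at hx
    obtain (⟨y, hy, rfl⟩ | ⟨y, hy, rfl⟩) | ⟨y, hy, rfl⟩ := hx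
    · exact key 0 (hz 0) y hy
    · exact key 1 (f_z_comm 0 1 ▸ hz 1) y hy
    · exact key 2 (f_z_comm 0 2 ▸ hz 2) y hy

lemma exists_mem_Aset_dist_mem_Icc {n : ℕ} {x : EuclideanSpace ℝ (Fin 2)} (hx : x ∈ Aset (n + 1))
    {r : ℝ} (hr : 0 < r) (h0 : r ≤ dist (z 0) x) :
    ∃ y ∈ Aset (n + 1), r ≤ dist y x ∧ dist y x ≤ r + (2 ^ n)⁻¹ := by
  by_contra! hcon
  have h : Aset (n + 1) ⊆ {a | r ≤ dist a x} := by
    refine Aset_subset_of_step n _ h0 fun a ha b hb haP hab => ?_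
    have h1 := hcon a ha haP
    have h2 := dist_triangle a b x
    change r ≤ dist b x
    linarith
  have hxx : r ≤ dist x x := h hx
  rw [dist_self] at hxx
  linarith

/-- The minimality of `C` over discrete balls controls all balls of comparable size centred in
the piece `S₀₁`. -/
lemma IsGasket.mul_hausdorffMeasure_le {S : Set (EuclideanSpace ℝ (Fin 2))} (hS : IsGasket S)
    (m : ℕ) {C : ℝ≥0∞}
    (hC : ∀ x ∈ Aset (m + 3) ∩ fword [0, 1] '' S, ∀ y ∈ Aset (m + 3),
      Real.sqrt 3 / 16 ≤ dist y x → dist y x ≤ Real.sqrt 3 / 8 + (2 ^ (m + 2))⁻¹ →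
        C ≤ ENNReal.ofReal ((2 * dist y x) ^ sDim) / muk (m + 3) (closedBall x (dist y x)))
    {x : EuclideanSpace ℝ (Fin 2)} (hx : x ∈ fword [0, 1] '' S) {d : ℝ}
    (hd1 : Real.sqrt 3 / 16 ≤ d) (hd2 : d < Real.sqrt 3 / 8) :
    C * μH[sDim] (S ∩ closedBall x d) ≤
      ENNReal.ofReal ((2 * (d + (2 ^ (m + 2))⁻¹)) ^ sDim) * μH[sDim] S := by
  classical
  obtain ⟨y, hy, rfl⟩ := hx
  obtain ⟨p, hp⟩ := hS.exists_cell m hy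
  set y' := fword (List.ofFn p.1) (z p.2) with hy'
  have hy'S : y' ∈ S := hS.fword_mem _ (hS.z_mem _)
  set x := fword [0, 1] y
  set x' := fword [0, 1] y' with hx'
  have hx'A : x' ∈ Aset (m + 3) := by
    have h := fword_z_mem_Aset (0 :: 1 :: List.ofFn p.1) p.2
    rw [List.length_cons, List.length_cons, List.length_ofFn] at h
    exact h
  have hxx' : dist x x' ≤ (2 ^ (m + 3))⁻¹ := by
    have h := hS.dist_corner_le hp
    have h4 : ((2 : ℝ) ^ (m + 3))⁻¹ = (2 ^ (m + 1))⁻¹ / 2 ^ 2 := by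
      rw [pow_add _ m 3, pow_add _ m 1]; field_simp
    rw [dist_fword, h4]
    simp only [List.length_cons, List.length_nil, zero_add, Nat.reduceAdd]
    gcongr
  have hhalf : ((2 : ℝ) ^ (m + 2))⁻¹ = (2 ^ (m + 3))⁻¹ + (2 ^ (m + 3))⁻¹ := by
    rw [pow_succ _ (m + 2)]; field_simp; norm_num
  have hz0 : Real.sqrt 3 / 16 ≤ dist (z 0) x' := by
    by_contra! hlt
    have h3 : 0 < Real.sqrt 3 := by positivity
    have h := abs_bary_sub_lt (t := 1 / 4) (hlt.trans (by linarith)) 0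
    have h1 := hS.bary_add_le hy'S (i := 0) (j := 1) (by decide)
    have h2 := hS.bary_nonneg hy'S 1
    simp only [hx', fword, Function.comp_apply, id, bary_f, bary_z, if_true, zero_ne_one,
      if_false, abs_lt] at h
    linarith [h.2]
  set r := d + ((2 : ℝ) ^ (m + 2))⁻¹ with hr
  obtain ⟨w, ⟨hwA, hwr⟩, hwmax⟩ := Set.exists_max_image {a | a ∈ Aset (m + 3) ∧ dist a x' ≤ r}
    (fun a => dist a x') ((finite_Aset (m + 2)).subset fun a ha => ha.1)
    ⟨x', hx'A, by
      rw [dist_self]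
      exact add_nonneg (le_trans (by positivity) hd1) (by positivity)⟩
  have hw1 : Real.sqrt 3 / 16 ≤ dist w x' := by
    obtain ⟨a, ha, ha1, ha2⟩ := exists_mem_Aset_dist_mem_Icc (n := m + 2) hx'A
      (by positivity) hz0
    exact ha1.trans (hwmax a ⟨ha, by linarith⟩)
  have hCw := hC x' ⟨hx'A, y', hy'S, rfl⟩ w hwA hw1 (by linarith)
  have hmuk : muk (m + 3) (closedBall x (d + (2 ^ (m + 3))⁻¹)) ≤
      muk (m + 3) (closedBall x' (dist w x')) := by
    rw [muk_succ_apply (m + 2) measurableSet_closedBall,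
      muk_succ_apply (m + 2) measurableSet_closedBall]
    refine Finset.sum_le_sum fun q _ => ?_
    by_cases hq : fword (List.ofFn q.1) (z q.2) ∈ closedBall x (d + (2 ^ (m + 3))⁻¹)
    · rw [if_pos hq, if_pos]
      have hqA : fword (List.ofFn q.1) (z q.2) ∈ Aset (m + 3) := by
        have h := fword_z_mem_Aset (List.ofFn q.1) q.2
        rwa [List.length_ofFn] at h
      refine hwmax _ ⟨hqA, ?_⟩
      have h1 := mem_closedBall.1 hq
      have h2 := dist_triangle (fword (List.ofFn q.1) (z q.2)) x x'
      linarith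
    · rw [if_neg hq]
      exact zero_le
  calc C * μH[sDim] (S ∩ closedBall x d)
      ≤ C * (muk (m + 3) (closedBall x' (dist w x')) * μH[sDim] S) := by
        gcongr
        exact (hS.hausdorffMeasure_inter_closedBall_le (m + 2) x d).trans
          (mul_le_mul_left hmuk _)
    _ = C * muk (m + 3) (closedBall x' (dist w x')) * μH[sDim] S := (mul_assoc ..).symm
    _ ≤ ENNReal.ofReal ((2 * dist w x') ^ sDim) * μH[sDim] S := by
        gcongr
        exact ENNReal.mul_le_of_le_div hCw
    _ ≤ _ := by
        have := sDim_pos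
        gcongr

/-- A density bound for balls of the scale `√3/16 ≤ d < √3/8` centred in `S₀₁` propagates to all
smaller centred balls. -/
lemma IsGasket.density_bound {S : Set (EuclideanSpace ℝ (Fin 2))} (hS : IsGasket S) {c : ℝ≥0∞}
    (hc : ∀ x ∈ fword [0, 1] '' S, ∀ d, Real.sqrt 3 / 16 ≤ d → d < Real.sqrt 3 / 8 →
      c * μH[sDim] (S ∩ closedBall x d) ≤ ENNReal.ofReal ((2 * d) ^ sDim) * μH[sDim] S)
    {x : EuclideanSpace ℝ (Fin 2)} (hx : x ∈ S) {d : ℝ} (hd0 : 0 < d) (hd : d < Real.sqrt 3 / 8) :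
    c * μH[sDim] (S ∩ closedBall x d) ≤ ENNReal.ofReal ((2 * d) ^ sDim) * μH[sDim] S := by
  have hsq : 0 < Real.sqrt 3 := by positivity
  have close : ∀ {t r : ℝ} {x y : EuclideanSpace ℝ (Fin 2)}, r < Real.sqrt 3 / 2 * t →
      y ∈ S ∩ closedBall x r → ∀ i, |bary i y - bary i x| < t := fun hr hy =>
    abs_bary_sub_lt ((mem_closedBall.1 hy.2).trans_lt hr)
  have mem_f : ∀ {y : EuclideanSpace ℝ (Fin 2)}, y ∈ S → ∀ i, (∀ j, j ≠ i → bary j y < 1 / 2) →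
      y ∈ f i '' S := by
    intro y hy i hi
    obtain ⟨j, w, hw, rfl⟩ := hS.exists_f_eq hy
    by_cases hji : j = i
    · exact hji ▸ ⟨w, hw, rfl⟩
    · have h1 := hi j hji
      have h2 := hS.bary_nonneg hw j
      rw [bary_f, if_pos rfl] at h1
      linarith
  have off : ∀ i j x d, x ∈ S → i ≠ j → Real.sqrt 3 / 16 ≤ d → d < Real.sqrt 3 / 8 →
      c * μH[sDim] (S ∩ closedBall (f i (f j x)) d) ≤
        ENNReal.ofReal ((2 * d) ^ sDim) * μH[sDim] S := by
    intro i j x d hx hij h1 h2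
    obtain ⟨σ, rfl, rfl⟩ : ∃ σ : Equiv.Perm (Fin 3), σ 0 = i ∧ σ 1 = j := by
      revert i j; decide
    refine (mul_le_mul_right ?_ c).trans (hc _ ⟨permute σ x, hS.permute_mem σ hx, rfl⟩ d h1 h2)
    have hfw : fword [0, 1] (permute σ x) = permute σ (f (σ 0) (f (σ 1) x)) := by
      rw [permute_f, permute_f]; rfl
    rw [hfw, ← (isometry_permute σ).hausdorffMeasure_image (Or.inl sDim_pos.le)]
    refine measure_mono ?_
    rintro _ ⟨y, hy, rfl⟩
    exact ⟨hS.permute_mem σ hy.1, by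
      rw [mem_closedBall, (isometry_permute σ).dist_eq]; exact hy.2⟩
  have base : ∀ x ∈ S, ∀ d, Real.sqrt 3 / 16 ≤ d → d < Real.sqrt 3 / 8 →
      c * μH[sDim] (S ∩ closedBall x d) ≤ ENNReal.ofReal ((2 * d) ^ sDim) * μH[sDim] S := by
    intro x hx d h1 h2
    obtain ⟨i, _, hx1, rfl⟩ := hS.exists_f_eq hx
    obtain ⟨j, x, hx2, rfl⟩ := hS.exists_f_eq hx1
    by_cases hij : i = j
    · subst hij
      obtain ⟨k, hk⟩ : ∃ k : Fin 3, k ≠ i := exists_ne i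
      refine (mul_le_mul_right ?_ c).trans (off k i x d hx2 hk h1 h2)
      have hiso : Isometry fun y : EuclideanSpace ℝ (Fin 2) => y + (v k - v i) :=
        isometry_add_right _
      have hshift : ∀ y, f i y + (v k - v i) = f k y := fun y => by simp only [f]; abel
      rw [← hiso.hausdorffMeasure_image (Or.inl sDim_pos.le)]
      refine measure_mono ?_
      rintro _ ⟨y, hy, rfl⟩
      have hb := close (t := 1 / 4) (by linarith) hy i
      have h0 := hS.bary_nonneg hx2 i
      rw [bary_f, bary_f, if_pos rfl, abs_lt] at hb
      obtain ⟨w, hw, rfl⟩ := mem_f hy.1 i fun j hj => by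
        linarith [hS.bary_add_le hy.1 hj, hb.1]
      refine ⟨?_, ?_⟩
      · simp only [hshift]
        exact hS.f_mem k hw
      · simp only [hshift]
        have := mem_closedBall.1 hy.2
        rw [dist_f] at this
        rwa [mem_closedBall, dist_f]
    · exact off i j x d hx2 hij h1 h2
  have scale : ∀ (g : EuclideanSpace ℝ (Fin 2) → EuclideanSpace ℝ (Fin 2)),
      (∀ x y, dist (g x) (g y) = dist x y / 2) → ∀ x d, 0 ≤ d → S ∩ closedBall (g x) d ⊆ g '' S →
      c * μH[sDim] (S ∩ closedBall x (2 * d)) ≤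
        ENNReal.ofReal ((2 * (2 * d)) ^ sDim) * μH[sDim] S →
      c * μH[sDim] (S ∩ closedBall (g x) d) ≤
        ENNReal.ofReal ((2 * d) ^ sDim) * μH[sDim] S := by
    intro g hg x d hd hsub h
    have hsub' : S ∩ closedBall (g x) d ⊆ g '' (S ∩ closedBall x (2 * d)) := by
      intro y hy
      obtain ⟨w, hw, rfl⟩ := hsub hy
      have := mem_closedBall.1 hy.2
      rw [hg] at this
      exact ⟨w, ⟨hw, mem_closedBall.2 (by linarith)⟩, rfl⟩
    rw [ofReal_two_mul_rpow_sDim (by positivity)] at h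
    rw [← ENNReal.mul_le_mul_iff_right (a := 3) (by norm_num) (by norm_num)]
    calc 3 * (c * μH[sDim] (S ∩ closedBall (g x) d))
        ≤ 3 * (c * μH[sDim] (g '' (S ∩ closedBall x (2 * d)))) := by gcongr
      _ = c * (3 * μH[sDim] (g '' (S ∩ closedBall x (2 * d)))) := by ring
      _ ≤ c * μH[sDim] (S ∩ closedBall x (2 * d)) := by
        gcongr
        exact hausdorffMeasure_image_le_div_three hg _
      _ ≤ _ := h.trans_eq (mul_assoc ..)
  have main : ∀ n : ℕ, ∀ x ∈ S, ∀ d, Real.sqrt 3 / 16 / 2 ^ n ≤ d → d < Real.sqrt 3 / 8 →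
      c * μH[sDim] (S ∩ closedBall x d) ≤ ENNReal.ofReal ((2 * d) ^ sDim) * μH[sDim] S := by
    intro n
    induction n with
    | zero => simpa using base
    | succ n ih =>
      intro x hx d hd1 hd2
      by_cases hd3 : Real.sqrt 3 / 16 ≤ d
      · exact base x hx d hd3 hd2
      push Not at hd3
      have hd0 : 0 ≤ d := le_trans (by positivity) hd1
      have ih' : ∀ x ∈ S, c * μH[sDim] (S ∩ closedBall x (2 * d)) ≤
          ENNReal.ofReal ((2 * (2 * d)) ^ sDim) * μH[sDim] S := fun x hx =>
        ih x hx (2 * d) (by rw [pow_succ, ← div_div] at hd1; linarith) (by linarith)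
      obtain ⟨i, _, hx1, rfl⟩ := hS.exists_f_eq hx
      obtain ⟨j, _, hx2, rfl⟩ := hS.exists_f_eq hx1
      obtain ⟨l, x, hx3, rfl⟩ := hS.exists_f_eq hx2
      by_cases hcorner : i ≠ j ∧ l = j
      · obtain ⟨hij, rfl⟩ := hcorner
        set g : EuclideanSpace ℝ (Fin 2) → EuclideanSpace ℝ (Fin 2) :=
          fun y => (1 / 2 : ℝ) • y + (1 / 2 : ℝ) • (v i + v l) with hg
        have hgi : ∀ y, g (f i y) = f i (f l y) := fun y => by
          simp only [hg, f]; module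
        have hgl : ∀ y, g (f l y) = f l (f i y) := fun y => by
          simp only [hg, f]; module
        have hgd : ∀ x y, dist (g x) (g y) = dist x y / 2 := fun x y => by
          simp only [hg, dist_add_right, dist_smul₀]
          norm_num
          ring
        rw [← hgi]
        refine scale g hgd _ d hd0 ?_ (ih' _ (hS.f_mem i hx2))
        rw [hgi]
        intro y hy
        have hb := close (t := 1 / 8) (by linarith) hy
        simp only [bary_f, abs_lt] at hb
        obtain ⟨a, _, hy1, rfl⟩ := hS.exists_f_eq hy.1
        obtain ⟨e, y, hy2, rfl⟩ := hS.exists_f_eq hy1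
        set w := f a (f e y) with hw
        have hx0 := hS.bary_nonneg hx3
        have hy0 := hS.bary_nonneg hy2
        have hwi : 3 / 8 < bary i w := by
          have h := (hb i).1
          rw [if_pos rfl, if_neg hij] at h
          linarith [hx0 i]
        have hwl : 1 / 4 < bary l w := by
          have h := (hb l).1
          rw [if_pos rfl, if_neg hij.symm] at h
          linarith [hx0 l]
        have hwk : ∀ k, k ≠ i → k ≠ l → bary k w < 1 / 4 := by
          intro k hki hkl
          have h := (hb k).2
          rw [if_neg hki, if_neg hkl] at h
          linarith [hx0 i, hS.bary_add_le hx3 hki]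
        have hwil := hS.bary_add_le hy.1 hij
        have hwa : 1 / 2 ≤ bary a w := by
          rw [hw, bary_f, if_pos rfl]
          linarith [hS.bary_nonneg hy1 a]
        have hwe : 1 / 4 + (if e = a then 1 / 2 else 0) ≤ bary e w := by
          rw [hw, bary_f, bary_f, if_pos rfl]
          split_ifs <;> linarith [hy0 e]
        have hae : (a = i ∧ e = l) ∨ (a = l ∧ e = i) := by
          have ha : a = i ∨ a = l := by
            by_contra! h
            linarith [hwk a h.1 h.2]
          have he : e = i ∨ e = l := by
            by_contra! h
            have := hwk e h.1 h.2
            split_ifs at hwe <;> linarith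
          have hea : e ≠ a := by
            rintro rfl
            rw [if_pos rfl] at hwe
            obtain rfl | rfl := ha <;> linarith
          grind
        obtain ⟨rfl, rfl⟩ | ⟨rfl, rfl⟩ := hae
        · exact ⟨f a y, hS.f_mem a hy2, hgi y⟩
        · exact ⟨f a y, hS.f_mem a hy2, hgl y⟩
      · refine scale (f i) (dist_f i) _ d hd0 ?_ (ih' _ hx1)
        intro y hy
        have hb := close (t := 1 / 8) (by linarith) hy
        simp only [abs_lt] at hb
        refine mem_f hy.1 i fun a ha => ?_
        have hba := (hb a).2
        have hx4 : bary a x ≤ 1 := by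
          have := hS.bary_add_le hx3 ha
          linarith [hS.bary_nonneg hx3 i]
        simp only [bary_f, if_neg ha] at hba
        by_cases haj : a = j
        · subst haj
          rw [if_pos rfl, if_neg fun h => hcorner ⟨ha.symm, h.symm⟩] at hba
          linarith
        · rw [if_neg haj] at hba
          split_ifs at hba <;> linarith
  obtain ⟨n, hn⟩ := pow_unbounded_of_one_lt (Real.sqrt 3 / 16 / d) (one_lt_two (α := ℝ))
  refine main n x hx d ?_ hd
  rw [div_lt_iff₀ hd0] at hn
  rw [div_le_iff₀ (by positivity)]
  linarith

lemma IsGasket.le_centredPremeasure {S : Set (EuclideanSpace ℝ (Fin 2))} (hS : IsGasket S)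
    (hSpos : 0 < μH[sDim] S) (hSfin : μH[sDim] S < ⊤) {c : ℝ≥0∞}
    (hc : ∀ x ∈ fword [0, 1] '' S, ∀ d, Real.sqrt 3 / 16 ≤ d → d < Real.sqrt 3 / 8 →
      c * μH[sDim] (S ∩ closedBall x d) ≤ ENNReal.ofReal ((2 * d) ^ sDim) * μH[sDim] S) :
    c ≤ centredPremeasure sDim S := by
  have hsq : 0 < Real.sqrt 3 := by positivity
  refine le_iSup₂_of_le (Real.sqrt 3 / 8) (by positivity) ?_
  refine le_iInf₂ fun x d => le_iInf₂ fun hx hd0 => le_iInf₂ fun hd hcov => ?_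
  have := Measure.nullSingletonClass_hausdorff (EuclideanSpace ℝ (Fin 2)) sDim_pos
  have hball : ∀ n, c * μH[sDim] (S ∩ closedBall (x n) (d n)) ≤
      ENNReal.ofReal ((2 * d n) ^ sDim) * μH[sDim] S := by
    intro n
    obtain h | h := (hd0 n).eq_or_lt
    · have h0 : μH[sDim] (S ∩ closedBall (x n) (d n)) = 0 := by
        refine measure_mono_null (inter_subset_right.trans ?_) (measure_singleton (x n))
        rw [← h, closedBall_zero]
      rw [h0, mul_zero]
      exact zero_le
    · exact hS.density_bound hc (hx n) h (by linarith [hd n])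
  rw [← ENNReal.mul_le_mul_iff_left hSpos.ne' hSfin.ne, ← ENNReal.tsum_mul_right]
  calc c * μH[sDim] S ≤ c * ∑' n, μH[sDim] (S ∩ closedBall (x n) (d n)) := by
        gcongr
        refine le_trans (measure_mono ?_) (measure_iUnion_le _)
        rw [← inter_iUnion]
        exact subset_inter subset_rfl hcov
    _ = ∑' n, c * μH[sDim] (S ∩ closedBall (x n) (d n)) := ENNReal.tsum_mul_left.symm
    _ ≤ _ := ENNReal.tsum_le_tsum hball

theorem statement16 (S : Set (EuclideanSpace ℝ (Fin 2))) (hScomp : IsCompact S) (hSne : S.Nonempty)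
    (hSinv : S = f 0 '' S ∪ f 1 '' S ∪ f 2 '' S)
    (hSpos : 0 < μH[sDim] S) (hSfin : μH[sDim] S < ⊤)
    (k : ℕ) (hk : 4 ≤ k) (xk yk : EuclideanSpace ℝ (Fin 2)) (dk : ℝ)
    (hxk : xk ∈ Aset k ∩ fword [0, 1] '' S) (hyk : yk ∈ Aset k) (hdk : dk = dist yk xk)
    (hdk1 : Real.sqrt 3 / 16 ≤ dk) (hdk2 : dk ≤ Real.sqrt 3 / 8 + (2 : ℝ) ^ ((1 : ℤ) - k))
    (hmin : ∀ x ∈ Aset k ∩ fword [0, 1] '' S, ∀ y ∈ Aset k,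
      Real.sqrt 3 / 16 ≤ dist y x → dist y x ≤ Real.sqrt 3 / 8 + (2 : ℝ) ^ ((1 : ℤ) - k) →
        ENNReal.ofReal ((2 * dk) ^ sDim) / muk k (closedBall xk dk) ≤
          ENNReal.ofReal ((2 * dist y x) ^ sDim) / muk k (closedBall x (dist y x))) :
    ENNReal.ofReal ((1 + (2 : ℝ) ^ ((5 : ℤ) - k) / Real.sqrt 3) ^ (-sDim)) *
        (ENNReal.ofReal ((2 * dk) ^ sDim) / muk k (closedBall xk dk)) ≤
      centredPremeasure sDim S ∧
    centredPremeasure sDim S ≤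
      ENNReal.ofReal ((2 * dk) ^ sDim) /
        muk k (closedBall xk (dk - (2 : ℝ) ^ (-(k : ℤ)))) := by
  have hS : IsGasket S := ⟨hScomp, hSne, hSinv⟩
  obtain ⟨m, rfl⟩ : ∃ m, k = m + 3 := ⟨k - 3, by omega⟩
  have hsq : 0 < Real.sqrt 3 := by positivity
  have hneg : (2 : ℝ) ^ (-((m + 3 : ℕ) : ℤ)) = (2 ^ (m + 3))⁻¹ := by
    rw [zpow_neg, zpow_natCast]
  have hone : (2 : ℝ) ^ ((1 : ℤ) - (m + 3 : ℕ)) = (2 ^ (m + 2))⁻¹ := by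
    rw [← zpow_natCast, ← zpow_neg]
    congr 1
  have hfive : (2 : ℝ) ^ ((5 : ℤ) - (m + 3 : ℕ)) = 16 * (2 ^ (m + 2))⁻¹ := by
    rw [← hone, show (16 : ℝ) = 2 ^ (4 : ℤ) by norm_num, ← zpow_add₀ two_ne_zero]
    congr 1
    ring
  rw [hone] at hmin
  rw [hneg, hfive]
  obtain ⟨y, hy, hyx⟩ := hxk.2
  refine ⟨hS.le_centredPremeasure hSpos hSfin fun x hx d hd1 hd2 => ?_,
    hS.centredPremeasure_le (m + 2) (hyx ▸ hS.fword_mem _ hy) (lt_of_lt_of_le (by positivity) hdk1)⟩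
  have hd0 : 0 < d := lt_of_lt_of_le (by positivity) hd1
  set ε : ℝ := (2 ^ (m + 2))⁻¹
  have hε : 0 < ε := by positivity
  set t : ℝ := 1 + 16 * ε / Real.sqrt 3 with ht
  have ht0 : 0 < t := by positivity
  have hdt : d + ε ≤ t * d := by
    have h1 : 16 * ε / Real.sqrt 3 * (Real.sqrt 3 / 16) = ε := by field_simp
    have h2 : 16 * ε / Real.sqrt 3 * (Real.sqrt 3 / 16) ≤ 16 * ε / Real.sqrt 3 * d := by gcongr
    rw [ht, add_mul, one_mul]
    linarith
  have hpow : t ^ (-sDim) * (2 * (d + ε)) ^ sDim ≤ (2 * d) ^ sDim := by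
    have hs := sDim_pos
    calc t ^ (-sDim) * (2 * (d + ε)) ^ sDim ≤ t ^ (-sDim) * (t * (2 * d)) ^ sDim := by
          exact mul_le_mul_of_nonneg_left
            (Real.rpow_le_rpow (by positivity) (by linarith) hs.le) (by positivity)
      _ = (2 * d) ^ sDim := by
          rw [Real.mul_rpow ht0.le (by positivity), ← mul_assoc, ← Real.rpow_add ht0]
          simp
  rw [mul_assoc]
  calc _ ≤ ENNReal.ofReal (t ^ (-sDim)) *
        (ENNReal.ofReal ((2 * (d + ε)) ^ sDim) * μH[sDim] S) := by
        exact mul_le_mul_right (hS.mul_hausdorffMeasure_le m hmin hx hd1 hd2) _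
    _ = ENNReal.ofReal (t ^ (-sDim) * (2 * (d + ε)) ^ sDim) * μH[sDim] S := by
        rw [ENNReal.ofReal_mul (by positivity), mul_assoc]
    _ ≤ _ := by gcongr

end
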